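/- Let {ν_{nk}} be an infinitesimal array of probability measures on ℝ and {c_n}_{n≥1} ⊂ ℝ, and assume L := sup_{n≥1} Σ_{k=1}^{k_n} ∫_ℝ t²/(1+t²) dν_{nk}°(t) < +∞. Then c_n + Σ_{k=1}^{k_n} E_{ν_{nk}}(iy) = o(y) uniformly in n as y → ∞ (i.e., for every ε > 0 there is Y > 0 such that |c_n + Σ_k E_{ν_{nk}}(iy)| ≤ εy for all n and all y ≥ Y) if and only if c_n + Σ_{k=1}^{k_n} [a_{nk} + f_{nk}(iy)] = o(y) uniformly in n as y → ∞. -/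

import Mathlib

open MeasureTheory Complex Filter Topology

noncomputable section

/-- Cauchy transform G_μ(z) = ∫ (z−t)⁻¹ dμ(t), z ∈ ℂ⁺. -/
def cauchyT (μ : Measure ℝ) (z : ℂ) : ℂ := ∫ t : ℝ, (z - (t : ℂ))⁻¹ ∂μ

/-- E_μ(z) = z − F_μ(z), where F_μ = 1/G_μ. -/
def ET (μ : Measure ℝ) (z : ℂ) : ℂ := z - (cauchyT μ z)⁻¹

/-- Infinitesimal triangular array on ℝ: max_{1≤k≤k_n} ν_{nk}{|t| ≥ ε} → 0 as n → ∞. -/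
def IsInfinitesimalArrayR (kn : ℕ → ℕ) (ν : ℕ → ℕ → Measure ℝ) : Prop :=
  ∀ ε : ℝ, 0 < ε → ∀ δ : ENNReal, 0 < δ → ∃ N : ℕ, ∀ n ≥ N, ∀ i < kn n,
    ν n i {t : ℝ | ε ≤ |t|} < δ

/-- a = ∫_{|t|<1} t dν(t). -/
def aR (ν : Measure ℝ) : ℝ := ∫ t in {t : ℝ | |t| < 1}, t ∂ν

/-- ν° : the centering of ν, pushforward under t ↦ t − a. -/
def centerR (ν : Measure ℝ) : Measure ℝ := Measure.map (fun t => t - aR ν) ν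

/-- f(z) = ∫ tz/(z−t) dν°(t). -/
def fR (ν : Measure ℝ) (z : ℂ) : ℂ :=
  ∫ t : ℝ, ((t : ℂ) * z) / (z - (t : ℂ)) ∂(centerR ν)

section Centering

variable (ν : Measure ℝ)

lemma integral_centerR {E : Type*} [NormedAddCommGroup E] [NormedSpace ℝ E] (g : ℝ → E) :
    ∫ s, g s ∂(centerR ν) = ∫ t, g (t - aR ν) ∂ν :=
  (MeasurableEquiv.subRight (aR ν)).measurableEmbedding.integral_map g

lemma measurableSet_abs_lt_one : MeasurableSet {t : ℝ | |t| < 1} :=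
  measurableSet_lt (by fun_prop) (by fun_prop)

/-- The second-moment-type weight `∫ t²/(1+t²) dν°`. -/
def centeredWeight : ℝ := ∫ t : ℝ, t ^ 2 / (1 + t ^ 2) ∂(centerR ν)

lemma centeredWeight_eq :
    centeredWeight ν = ∫ t, (t - aR ν) ^ 2 / (1 + (t - aR ν) ^ 2) ∂ν :=
  integral_centerR ν _

lemma centeredWeight_nonneg : 0 ≤ centeredWeight ν :=
  integral_nonneg fun t => by positivity

lemma sq_div_one_add_sq_le_one (s : ℝ) : s ^ 2 / (1 + s ^ 2) ≤ 1 := by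
  rw [div_le_one (by positivity)]
  linarith

lemma sq_div_one_add_sq_le_abs (s : ℝ) : s ^ 2 / (1 + s ^ 2) ≤ |s| := by
  rw [div_le_iff₀ (by positivity), ← sq_abs s]
  nlinarith [abs_nonneg s, mul_nonneg (abs_nonneg s) (sq_nonneg (|s| - 1))]

lemma aR_eq_integral_indicator : aR ν = ∫ t, {t : ℝ | |t| < 1}.indicator (fun t => t) t ∂ν :=
  (integral_indicator measurableSet_abs_lt_one).symm

variable [IsProbabilityMeasure ν]

lemma integrable_centeredWeight :
    Integrable (fun t => (t - aR ν) ^ 2 / (1 + (t - aR ν) ^ 2)) ν := by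
  refine Integrable.of_bound (C := 1)
    (Measurable.aestronglyMeasurable (by fun_prop)) (ae_of_all _ fun t => ?_)
  rw [Real.norm_of_nonneg (by positivity)]
  exact sq_div_one_add_sq_le_one _

lemma integrable_indicator_abs_lt_one :
    Integrable ({t : ℝ | |t| < 1}.indicator fun t => t) ν := by
  refine Integrable.of_bound (C := 1)
    (measurable_id.indicator measurableSet_abs_lt_one).aestronglyMeasurable
    (ae_of_all _ fun t => ?_)
  by_cases ht : |t| < 1 <;> simp [Set.indicator, ht, le_of_lt]

lemma integral_const_add_indicator {η : ℝ} (C : ℝ) :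
    ∫ t, (C + {t : ℝ | η ≤ |t|}.indicator (fun _ => (1 : ℝ)) t) ∂ν
      = C + ν.real {t : ℝ | η ≤ |t|} := by
  have hm : MeasurableSet {t : ℝ | η ≤ |t|} := measurableSet_le (by fun_prop) (by fun_prop)
  rw [integral_add (integrable_const _) ((integrable_const _).indicator hm),
    integral_indicator_const _ hm]
  simp

lemma abs_aR_le {η : ℝ} (hη : 0 < η) : |aR ν| ≤ η + ν.real {t : ℝ | η ≤ |t|} := by
  have hm : MeasurableSet {t : ℝ | η ≤ |t|} := measurableSet_le (by fun_prop) (by fun_prop)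
  rw [aR_eq_integral_indicator, ← integral_const_add_indicator, ← Real.norm_eq_abs]
  refine norm_integral_le_of_norm_le
    ((integrable_const _).add ((integrable_const _).indicator hm)) (ae_of_all _ fun t => ?_)
  by_cases h1 : |t| < 1 <;> by_cases h2 : η ≤ |t| <;> simp [Set.indicator, h1, h2] <;> linarith

lemma centeredWeight_le {η : ℝ} (hη : 0 < η) :
    centeredWeight ν ≤ η + |aR ν| + ν.real {t : ℝ | η ≤ |t|} := by
  have hm : MeasurableSet {t : ℝ | η ≤ |t|} := measurableSet_le (by fun_prop) (by fun_prop)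
  rw [centeredWeight_eq, ← integral_const_add_indicator]
  refine integral_mono (integrable_centeredWeight ν)
    ((integrable_const _).add ((integrable_const _).indicator hm)) fun t => ?_
  have h1 := sq_div_one_add_sq_le_one (t - aR ν)
  have h2 := sq_div_one_add_sq_le_abs (t - aR ν)
  have h3 := abs_sub t (aR ν)
  by_cases h : η ≤ |t|
  · simp only [Set.indicator, Set.mem_ofPred_eq, h, if_true]
    linarith [abs_nonneg (aR ν)]
  · simp only [Set.indicator, Set.mem_ofPred_eq, h, if_false]
    linarith

end Centering

section Pointwise

lemma norm_I_mul_sub_ofReal_sq (y t : ℝ) : ‖I * (y : ℂ) - t‖ ^ 2 = y ^ 2 + t ^ 2 := by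
  rw [← normSq_eq_norm_sq, normSq_apply]
  simp
  ring

lemma le_norm_I_mul_sub_ofReal (y t : ℝ) : y ≤ ‖I * (y : ℂ) - t‖ := by
  simpa using (le_abs_self _).trans (abs_im_le_norm (I * (y : ℂ) - t))

lemma abs_le_norm_I_mul_sub_ofReal (y t : ℝ) : |t| ≤ ‖I * (y : ℂ) - t‖ := by
  simpa using abs_re_le_norm (I * (y : ℂ) - t)

lemma I_mul_sub_ofReal_ne_zero {y : ℝ} (hy : 0 < y) (t : ℝ) : I * (y : ℂ) - t ≠ 0 :=
  norm_pos_iff.mp (hy.trans_le (le_norm_I_mul_sub_ofReal y t))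

/-- After subtracting the truncated identity, the kernel of the shifted transform is controlled
by the weight `s²/(1+s²)`, `s = t - a`. -/
lemma norm_shifted_kernel_sub_le {a y : ℝ} (ha : |a| ≤ 1 / 2) (hy : 1 ≤ y) (t : ℝ) :
    ‖((t - a : ℝ) : ℂ) * (I * y - a) / (I * y - t)
        - (({t : ℝ | |t| < 1}.indicator (fun t => t) t - a : ℝ) : ℂ)‖
      ≤ 15 * y * ((t - a) ^ 2 / (1 + (t - a) ^ 2)) := by
  have hz := I_mul_sub_ofReal_ne_zero (by linarith : 0 < y) t
  have hzy := le_norm_I_mul_sub_ofReal y t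
  have hzt := abs_le_norm_I_mul_sub_ofReal y t
  have hsq : 0 ≤ (t - a) ^ 2 := sq_nonneg _
  obtain ⟨ha1, ha2⟩ := abs_le.mp ha
  by_cases ht : |t| < 1
  · have heq : ((t - a : ℝ) : ℂ) * (I * y - a) / (I * y - t) - ((t - a : ℝ) : ℂ)
        = ((t - a : ℝ) : ℂ) ^ 2 / (I * y - t) := by
      field_simp
      push_cast
      ring
    simp only [Set.indicator, Set.mem_ofPred_eq, ht, if_true]
    rw [heq, norm_div, norm_pow, norm_real, Real.norm_eq_abs, sq_abs]
    obtain ⟨ht1, ht2⟩ := abs_lt.mp ht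
    have hs : (t - a) ^ 2 ≤ 9 / 4 := by nlinarith
    calc (t - a) ^ 2 / ‖I * (y : ℂ) - t‖ ≤ (t - a) ^ 2 / 1 := by gcongr; linarith
      _ ≤ 15 * 1 * ((t - a) ^ 2 / (1 + (t - a) ^ 2)) := by
        rw [div_one, mul_div_assoc', le_div_iff₀ (by positivity)]
        nlinarith
      _ ≤ _ := by gcongr
  · simp only [Set.indicator, Set.mem_ofPred_eq, ht, if_false]
    push Not at ht
    have hq : 1 / 5 ≤ (t - a) ^ 2 / (1 + (t - a) ^ 2) := by
      rw [div_le_div_iff₀ (by norm_num) (by positivity)]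
      rcases le_abs.mp ht with h | h <;> nlinarith
    have hw : ‖I * (y : ℂ) - a‖ ≤ 3 / 2 * y := by
      refine (norm_sub_le _ _).trans ?_
      rw [norm_mul, norm_I, norm_real, norm_real, Real.norm_eq_abs, Real.norm_eq_abs,
        abs_of_pos (by linarith : 0 < y)]
      linarith
    have hs : |t - a| ≤ 3 / 2 * ‖I * (y : ℂ) - t‖ := (abs_sub t a).trans (by linarith)
    have hk : ‖((t - a : ℝ) : ℂ) * (I * y - a) / (I * y - t)‖ ≤ 9 / 4 * y := by
      rw [norm_div, norm_mul, norm_real, Real.norm_eq_abs, div_le_iff₀ (norm_pos_iff.mpr hz)]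
      calc |t - a| * ‖I * (y : ℂ) - a‖ ≤ (3 / 2 * ‖I * (y : ℂ) - t‖) * (3 / 2 * y) := by gcongr
        _ = _ := by ring
    refine (norm_sub_le _ _).trans ?_
    rw [norm_real, Real.norm_eq_abs, zero_sub, abs_neg]
    nlinarith

lemma norm_kernel_sub_shifted_kernel_le {a y : ℝ} (ha : |a| ≤ 1 / 2) (hy : 1 ≤ y) (t : ℝ) :
    ‖((t - a : ℝ) : ℂ) * (I * y - a) / (I * y - t)
        - ((t - a : ℝ) : ℂ) * (I * y) / (I * y - ((t - a : ℝ) : ℂ))‖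
      ≤ (t - a) ^ 2 / (1 + (t - a) ^ 2) := by
  have hz := I_mul_sub_ofReal_ne_zero (by linarith : 0 < y) t
  have hz' := I_mul_sub_ofReal_ne_zero (by linarith : 0 < y) (t - a)
  have heq : ((t - a : ℝ) : ℂ) * (I * y - a) / (I * y - t)
        - ((t - a : ℝ) : ℂ) * (I * y) / (I * y - ((t - a : ℝ) : ℂ))
      = (a : ℂ) * ((t - a : ℝ) : ℂ) ^ 2 / ((I * y - t) * (I * y - ((t - a : ℝ) : ℂ))) := by
    rw [div_sub_div _ _ hz hz']
    congr 1
    push_cast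
    ring
  have h1 := norm_I_mul_sub_ofReal_sq y t
  have h2 := norm_I_mul_sub_ofReal_sq y (t - a)
  obtain ⟨ha1, ha2⟩ := abs_le.mp ha
  have hden : (1 + (t - a) ^ 2) / 2
      ≤ ‖I * (y : ℂ) - t‖ * ‖I * (y : ℂ) - ((t - a : ℝ) : ℂ)‖ := by
    refine le_of_sq_le_sq ?_ (by positivity)
    rw [mul_pow, h1, h2, div_pow]
    have e1 : 1 + (t - a) ^ 2 ≤ 2 * (y ^ 2 + t ^ 2) := by nlinarith [sq_nonneg (t + a)]
    have e2 : 1 + (t - a) ^ 2 ≤ y ^ 2 + (t - a) ^ 2 := by nlinarith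
    nlinarith [mul_le_mul e1 e2 (by positivity) (by positivity)]
  rw [heq, norm_div, norm_mul, norm_mul, norm_pow, norm_real, norm_real, Real.norm_eq_abs,
    Real.norm_eq_abs, sq_abs]
  calc |a| * (t - a) ^ 2 / (‖I * (y : ℂ) - t‖ * ‖I * (y : ℂ) - ((t - a : ℝ) : ℂ)‖)
      ≤ 1 / 2 * (t - a) ^ 2 / ((1 + (t - a) ^ 2) / 2) := by gcongr
    _ = _ := by field_simp

end Pointwise

section SingleMeasure

variable (ν : Measure ℝ)

instance isProbabilityMeasure_centerR [IsProbabilityMeasure ν] : IsProbabilityMeasure (centerR ν) :=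
  Measure.isProbabilityMeasure_map (by fun_prop)

lemma fR_eq (z : ℂ) : fR ν z
    = ∫ t : ℝ, ((t - aR ν : ℝ) : ℂ) * z / (z - ((t - aR ν : ℝ) : ℂ)) ∂ν :=
  integral_centerR ν fun s => (s : ℂ) * z / (z - (s : ℂ))

variable [IsProbabilityMeasure ν]

lemma integrable_cauchy_kernel {y : ℝ} (hy : 0 < y) :
    Integrable (fun t : ℝ => (I * (y : ℂ) - t)⁻¹) ν := by
  refine Integrable.of_bound (C := y⁻¹)
    (Measurable.aestronglyMeasurable (by fun_prop)) (ae_of_all _ fun t => ?_)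
  rw [norm_inv]
  exact inv_anti₀ hy (le_norm_I_mul_sub_ofReal y t)

lemma integrable_div_I_mul_sub {y : ℝ} (hy : 0 < y) :
    Integrable (fun t : ℝ => (t : ℂ) / (I * (y : ℂ) - t)) ν := by
  refine Integrable.of_bound (C := 1)
    (Measurable.aestronglyMeasurable (by fun_prop)) (ae_of_all _ fun t => ?_)
  rw [norm_div, norm_real, Real.norm_eq_abs]
  exact div_le_one_of_le₀ (abs_le_norm_I_mul_sub_ofReal y t) (norm_nonneg _)

lemma tendsto_integral_div_I_mul_sub :
    Tendsto (fun y : ℝ => ∫ t : ℝ, (t : ℂ) / (I * (y : ℂ) - t) ∂ν) atTop (𝓝 0) := by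
  rw [← integral_zero ℝ ℂ (μ := ν)]
  refine tendsto_integral_filter_of_dominated_convergence (fun _ => (1 : ℝ))
    (Eventually.of_forall fun y => Measurable.aestronglyMeasurable (by fun_prop))
    (Eventually.of_forall fun y => ae_of_all _ fun t => ?_) (integrable_const _)
    (ae_of_all _ fun t => ?_)
  · rw [norm_div, norm_real, Real.norm_eq_abs]
    exact div_le_one_of_le₀ (abs_le_norm_I_mul_sub_ofReal y t) (norm_nonneg _)
  · refine squeeze_zero_norm' (a := fun y : ℝ => |t| / y) ?_ (tendsto_const_nhds.div_atTop tendsto_id)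
    filter_upwards [eventually_gt_atTop 0] with y hy
    rw [norm_div, norm_real, Real.norm_eq_abs]
    gcongr
    exact le_norm_I_mul_sub_ofReal y t

lemma cauchyT_mul_eq {y : ℝ} (hy : 0 < y) (a : ℂ) :
    cauchyT ν (I * y) * (I * y - a) = 1 + ∫ t : ℝ, ((t : ℂ) - a) / (I * (y : ℂ) - t) ∂ν := by
  have hint : Integrable (fun t : ℝ => ((t : ℂ) - a) / (I * (y : ℂ) - t)) ν := by
    simp only [sub_div, div_eq_mul_inv a]
    exact (integrable_div_I_mul_sub ν hy).sub ((integrable_cauchy_kernel ν hy).const_mul a)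
  have h1 : (1 : ℂ) = ∫ _ : ℝ, (1 : ℂ) ∂ν := by simp
  rw [cauchyT, ← integral_mul_const, h1, ← integral_add (integrable_const _) hint]
  refine integral_congr_ae (ae_of_all _ fun t => ?_)
  have hz := I_mul_sub_ofReal_ne_zero hy t
  simp only
  field_simp
  ring

lemma isLittleO_mul_I_mul {K : ℝ → ℂ} (hK : Tendsto K atTop (𝓝 0)) :
    (fun y : ℝ => K y * (I * (y : ℂ))) =o[atTop] (fun y : ℝ => y) := by
  have hy : (fun y : ℝ => I * (y : ℂ)) =O[atTop] (fun y : ℝ => y) :=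
    Asymptotics.isBigO_of_le _ fun y => by simp
  simpa using ((Asymptotics.isLittleO_one_iff ℝ).mpr hK).mul_isBigO hy

lemma isLittleO_fR :
    (fun y : ℝ => fR ν (I * (y : ℂ))) =o[atTop] (fun y : ℝ => y) := by
  have h := tendsto_integral_div_I_mul_sub (centerR ν)
  have heq : (fun y : ℝ => fR ν (I * (y : ℂ)))
      = fun y : ℝ => (∫ t : ℝ, (t : ℂ) / (I * (y : ℂ) - t) ∂(centerR ν)) * (I * (y : ℂ)) := by
    ext y
    rw [fR, ← integral_mul_const]
    congr 1 with t
    ring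
  rw [heq]
  exact isLittleO_mul_I_mul h

lemma isLittleO_ET :
    (fun y : ℝ => ET ν (I * (y : ℂ))) =o[atTop] (fun y : ℝ => y) := by
  set K : ℝ → ℂ := fun y => ∫ t : ℝ, (t : ℂ) / (I * (y : ℂ) - t) ∂ν with hK
  have h : Tendsto K atTop (𝓝 0) := tendsto_integral_div_I_mul_sub ν
  have h1 : Tendsto (fun y => 1 - (1 + K y)⁻¹) atTop (𝓝 0) := by
    simpa using ((h.const_add 1).inv₀ (by simp)).const_sub (1 : ℂ)
  have heq : (fun y : ℝ => (1 - (1 + K y)⁻¹) * (I * (y : ℂ)))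
      =ᶠ[atTop] fun y : ℝ => ET ν (I * (y : ℂ)) := by
    filter_upwards [eventually_gt_atTop 0] with y hy
    have hG := cauchyT_mul_eq ν hy 0
    simp only [sub_zero] at hG
    have hz : I * (y : ℂ) ≠ 0 := by simpa using hy.ne'
    rw [ET, hK]
    simp only
    rw [← hG, mul_inv, sub_mul, one_mul, inv_mul_cancel_right₀ hz]
  refine Asymptotics.IsLittleO.congr' ?_ heq EventuallyEq.rfl
  exact isLittleO_mul_I_mul h1

/-- The transform `f` of `ν°` evaluated at the shifted point `iy - a`. -/
def shiftedF (y : ℝ) : ℂ :=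
  ∫ t : ℝ, ((t - aR ν : ℝ) : ℂ) * (I * y - aR ν) / (I * y - t) ∂ν

lemma integrable_shifted_kernel {y : ℝ} (hy : 0 < y) :
    Integrable (fun t : ℝ => ((t - aR ν : ℝ) : ℂ) * (I * y - aR ν) / (I * y - t)) ν := by
  have h := ((integrable_div_I_mul_sub ν hy).sub
    ((integrable_cauchy_kernel ν hy).const_mul (aR ν : ℂ))).mul_const (I * y - aR ν)
  refine h.congr (ae_of_all _ fun t => ?_)
  simp only [Pi.sub_apply]
  push_cast
  ring

lemma norm_shiftedF_le (ha : |aR ν| ≤ 1 / 2) {y : ℝ} (hy : 1 ≤ y) :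
    ‖shiftedF ν y‖ ≤ 15 * y * centeredWeight ν := by
  have hind := integrable_indicator_abs_lt_one ν
  have hcenter : ∫ t, (({t : ℝ | |t| < 1}.indicator (fun t => t) t - aR ν : ℝ) : ℂ) ∂ν = 0 := by
    rw [integral_complex_ofReal, integral_sub hind (integrable_const _), ← aR_eq_integral_indicator]
    simp
  have hsub : shiftedF ν y = ∫ t : ℝ, (((t - aR ν : ℝ) : ℂ) * (I * y - aR ν) / (I * y - t)
      - (({t : ℝ | |t| < 1}.indicator (fun t => t) t - aR ν : ℝ) : ℂ)) ∂ν := by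
    have hint : Integrable
        (fun t => (({t : ℝ | |t| < 1}.indicator (fun t => t) t - aR ν : ℝ) : ℂ)) ν :=
      (hind.sub (integrable_const (aR ν))).ofReal
    rw [integral_sub (integrable_shifted_kernel ν (by linarith)) hint, hcenter, sub_zero,
      shiftedF]
  rw [hsub, centeredWeight_eq, ← integral_const_mul]
  exact norm_integral_le_of_norm_le ((integrable_centeredWeight ν).const_mul _)
    (ae_of_all _ fun t => norm_shifted_kernel_sub_le ha hy t)

lemma norm_shiftedF_sub_fR_le (ha : |aR ν| ≤ 1 / 2) {y : ℝ} (hy : 1 ≤ y) :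
    ‖shiftedF ν y - fR ν (I * y)‖ ≤ centeredWeight ν := by
  have hint : Integrable (fun t : ℝ => ((t - aR ν : ℝ) : ℂ) * (I * y)
      / (I * y - ((t - aR ν : ℝ) : ℂ))) ν := by
    have h := (integrable_div_I_mul_sub (centerR ν) (by linarith : 0 < y)).mul_const (I * y)
    have h' := ((MeasurableEquiv.subRight (aR ν)).measurableEmbedding.integrable_map_iff).mp h
    refine h'.congr (ae_of_all _ fun t => ?_)
    exact div_mul_eq_mul_div _ _ _
  rw [fR_eq, shiftedF, ← integral_sub (integrable_shifted_kernel ν (by linarith)) hint,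
    centeredWeight_eq]
  exact norm_integral_le_of_norm_le (integrable_centeredWeight ν)
    (ae_of_all _ fun t => norm_kernel_sub_shifted_kernel_le ha hy t)

lemma cauchyT_mul_sq_eq {y : ℝ} (hy : 0 < y) :
    cauchyT ν (I * y) * (I * y - aR ν) ^ 2 = (I * y - aR ν) + shiftedF ν y := by
  rw [sq, ← mul_assoc, cauchyT_mul_eq ν hy, add_mul, one_mul, ← integral_mul_const, shiftedF]
  congr 2 with t
  push_cast
  ring

lemma norm_ET_sub_le (ha : |aR ν| ≤ 1 / 2) (hb : centeredWeight ν ≤ 1 / 30) {y : ℝ}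
    (hy : 1 ≤ y) :
    ‖ET ν (I * y) - (aR ν + fR ν (I * y))‖
      ≤ 450 * y * centeredWeight ν ^ 2 + centeredWeight ν := by
  have hy0 : 0 < y := by linarith
  have hG := cauchyT_mul_sq_eq ν hy0
  have hh := norm_shiftedF_le ν ha hy
  have hf := norm_shiftedF_sub_fR_le ν ha hy
  have hw := I_mul_sub_ofReal_ne_zero hy0 (aR ν)
  have hwy := le_norm_I_mul_sub_ofReal y (aR ν)
  set b := centeredWeight ν
  set w : ℂ := I * y - aR ν with hw_def
  set h := shiftedF ν y
  have hden : y / 2 ≤ ‖w + h‖ := by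
    have h1 := norm_sub_norm_le w (-h)
    rw [sub_neg_eq_add, norm_neg] at h1
    nlinarith
  have hden0 : w + h ≠ 0 := norm_pos_iff.mp (by linarith)
  have hinv : (cauchyT ν (I * y))⁻¹ = w ^ 2 / (w + h) := by
    rw [← hG]
    have : cauchyT ν (I * y) ≠ 0 := fun h0 => hden0 (by rw [← hG, h0, zero_mul])
    field_simp
  have heq : ET ν (I * y) - (aR ν + fR ν (I * y))
      = -(h ^ 2 / (w + h)) + (h - fR ν (I * y)) := by
    have hz : I * (y : ℂ) = w + aR ν := by rw [hw_def]; ring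
    rw [ET, hinv]
    nth_rewrite 1 [hz]
    field_simp
    ring
  rw [heq]
  refine (norm_add_le _ _).trans (add_le_add ?_ hf)
  rw [norm_neg, norm_div, norm_pow]
  calc ‖h‖ ^ 2 / ‖w + h‖ ≤ (15 * y * b) ^ 2 / (y / 2) := by gcongr
    _ = _ := by field_simp; ring

end SingleMeasure

lemma uniform_littleO_of_sub {A B : ℕ → ℝ → ℂ}
    (hAB : ∀ δ : ℝ, 0 < δ → ∃ Y : ℝ, 0 < Y ∧ ∀ n : ℕ, ∀ y : ℝ, Y ≤ y → ‖A n y - B n y‖ ≤ δ * y)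
    (hA : ∀ δ : ℝ, 0 < δ → ∃ Y : ℝ, 0 < Y ∧ ∀ n : ℕ, ∀ y : ℝ, Y ≤ y → ‖A n y‖ ≤ δ * y) :
    ∀ δ : ℝ, 0 < δ → ∃ Y : ℝ, 0 < Y ∧ ∀ n : ℕ, ∀ y : ℝ, Y ≤ y → ‖B n y‖ ≤ δ * y := by
  intro δ hδ
  obtain ⟨Y₁, hY₁, h₁⟩ := hAB (δ / 2) (half_pos hδ)
  obtain ⟨Y₂, hY₂, h₂⟩ := hA (δ / 2) (half_pos hδ)
  refine ⟨max Y₁ Y₂, lt_max_of_lt_left hY₁, fun n y hy => ?_⟩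
  have := norm_sub_le (A n y) (A n y - B n y)
  rw [sub_sub_cancel] at this
  linarith [h₁ n y (le_of_max_le_left hy), h₂ n y (le_of_max_le_right hy)]

lemma uniform_littleO_of_eventually {D : ℕ → ℝ → ℂ}
    (hD : ∀ n, D n =o[atTop] (fun y : ℝ => y))
    (hunif : ∀ δ : ℝ, 0 < δ → ∃ N : ℕ, ∃ Y : ℝ, ∀ n ≥ N, ∀ y : ℝ, Y ≤ y → ‖D n y‖ ≤ δ * y) :
    ∀ δ : ℝ, 0 < δ → ∃ Y : ℝ, 0 < Y ∧ ∀ n : ℕ, ∀ y : ℝ, Y ≤ y → ‖D n y‖ ≤ δ * y := by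
  intro δ hδ
  obtain ⟨N, Y₁, h₁⟩ := hunif δ hδ
  have h₂ : ∀ᶠ y in atTop, ∀ n ∈ Finset.range N, ‖D n y‖ ≤ δ * ‖y‖ :=
    (Filter.eventually_all_finset _).mpr fun n _ => (hD n).bound hδ
  obtain ⟨Y₂, h₂⟩ := eventually_atTop.mp h₂
  refine ⟨max 1 (max Y₁ Y₂), by positivity, fun n y hy => ?_⟩
  simp only [max_le_iff] at hy
  by_cases hn : n < N
  · have := h₂ y hy.2.2 n (Finset.mem_range.mpr hn)
    rwa [Real.norm_of_nonneg (by linarith)] at this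
  · exact h₁ n (not_lt.mp hn) y hy.2.1

/-- In an infinitesimal array, the truncated means and the weights are uniformly small. -/
lemma IsInfinitesimalArrayR.exists_small {kn : ℕ → ℕ} {ν : ℕ → ℕ → Measure ℝ}
    (hinf : IsInfinitesimalArrayR kn ν) (hprob : ∀ n i, IsProbabilityMeasure (ν n i))
    {η : ℝ} (hη : 0 < η) :
    ∃ N : ℕ, ∀ n ≥ N, ∀ i < kn n, |aR (ν n i)| ≤ η ∧ centeredWeight (ν n i) ≤ η := by
  obtain ⟨N, hN⟩ := hinf (η / 4) (by positivity) (ENNReal.ofReal (η / 4)) (by simpa using hη)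
  refine ⟨N, fun n hn i hi => ?_⟩
  have hm : (ν n i).real {t : ℝ | η / 4 ≤ |t|} ≤ η / 4 :=
    ENNReal.toReal_le_of_le_ofReal (by positivity) (hN n hn i hi).le
  have h1 := abs_aR_le (ν n i) (by positivity : 0 < η / 4)
  have h2 := centeredWeight_le (ν n i) (by positivity : 0 < η / 4)
  constructor <;> linarith

lemma uniform_littleO_sum_ET_sub {kn : ℕ → ℕ} {ν : ℕ → ℕ → Measure ℝ}
    (hprob : ∀ n i, IsProbabilityMeasure (ν n i)) (hinf : IsInfinitesimalArrayR kn ν)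
    {L : ℝ} (hL : ∀ n, ∑ i ∈ Finset.range (kn n), centeredWeight (ν n i) ≤ L) :
    ∀ δ : ℝ, 0 < δ → ∃ Y : ℝ, 0 < Y ∧ ∀ n : ℕ, ∀ y : ℝ, Y ≤ y →
      ‖∑ i ∈ Finset.range (kn n),
        (ET (ν n i) (I * y) - (aR (ν n i) + fR (ν n i) (I * y)))‖ ≤ δ * y := by
  refine uniform_littleO_of_eventually (D := fun n y => ∑ i ∈ Finset.range (kn n),
    (ET (ν n i) (I * y) - (aR (ν n i) + fR (ν n i) (I * y)))) (fun n => ?_) fun δ hδ => ?_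
  · refine Asymptotics.IsLittleO.fun_sum fun i _ => (isLittleO_ET (ν n i)).sub
      (Asymptotics.IsLittleO.add ?_ (isLittleO_fR (ν n i)))
    exact Asymptotics.isLittleO_const_left.mpr (Or.inr tendsto_norm_atTop_atTop)
  · have hL0 : 0 ≤ L :=
      (Finset.sum_nonneg fun i _ => centeredWeight_nonneg (ν 0 i)).trans (hL 0)
    set η := min (1 / 30) (δ / (900 * (L + 1))) with hη_def
    have hη : 0 < η := by positivity
    have hηL : 450 * η * L ≤ δ / 2 := by
      have : η * (900 * (L + 1)) ≤ δ := (le_div_iff₀ (by positivity)).mp (min_le_right _ _)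
      nlinarith
    obtain ⟨N, hN⟩ := hinf.exists_small hprob hη
    refine ⟨N, max 1 (2 * L / δ), fun n hn y hy => ?_⟩
    have hy1 := le_of_max_le_left hy
    have hy2 : 2 * L ≤ y * δ := (div_le_iff₀ hδ).mp (le_of_max_le_right hy)
    calc _ ≤ ∑ i ∈ Finset.range (kn n), (450 * y * η + 1) * centeredWeight (ν n i) := by
          refine norm_sum_le_of_le _ fun i hi => ?_
          obtain ⟨ha, hb⟩ := hN n hn i (Finset.mem_range.mp hi)
          have hη30 : η ≤ 1 / 30 := min_le_left _ _
          have hb0 := centeredWeight_nonneg (ν n i)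
          refine (norm_ET_sub_le (ν n i) (by linarith) (by linarith) hy1).trans ?_
          have := mul_le_mul_of_nonneg_left (mul_le_mul_of_nonneg_right hb hb0)
            (by positivity : 0 ≤ 450 * y)
          linarith
      _ = (450 * y * η + 1) * ∑ i ∈ Finset.range (kn n), centeredWeight (ν n i) :=
          (Finset.mul_sum _ _ _).symm
      _ ≤ (450 * y * η + 1) * L := by gcongr; exact hL n
      _ ≤ δ * y := by nlinarith

/-- Proposition 5.2 (2): if L = sup_n Σ_k ∫ t²/(1+t²) dν_{nk}° < ∞, then
c_n + Σ_k E_{ν_{nk}}(iy) = o(y) uniformly in n as y → ∞ iff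
c_n + Σ_k [a_{nk} + f_{nk}(iy)] = o(y) uniformly in n as y → ∞. -/
theorem stmt17
    (kn : ℕ → ℕ) (ν : ℕ → ℕ → Measure ℝ)
    (hprob : ∀ n i, IsProbabilityMeasure (ν n i))
    (hinf : IsInfinitesimalArrayR kn ν)
    (c : ℕ → ℝ)
    (hL : ∃ L : ℝ, ∀ n : ℕ,
      ∑ i ∈ Finset.range (kn n),
        ∫ t : ℝ, t ^ 2 / (1 + t ^ 2) ∂(centerR (ν n i)) ≤ L) :
    (∀ δ : ℝ, 0 < δ → ∃ Y : ℝ, 0 < Y ∧ ∀ n : ℕ, ∀ y : ℝ, Y ≤ y →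
      ‖((c n : ℝ) : ℂ) + ∑ i ∈ Finset.range (kn n),
          ET (ν n i) (Complex.I * (y : ℂ))‖ ≤ δ * y) ↔
    (∀ δ : ℝ, 0 < δ → ∃ Y : ℝ, 0 < Y ∧ ∀ n : ℕ, ∀ y : ℝ, Y ≤ y →
      ‖((c n : ℝ) : ℂ) + ∑ i ∈ Finset.range (kn n),
          (((aR (ν n i) : ℝ) : ℂ) + fR (ν n i) (Complex.I * (y : ℂ)))‖ ≤ δ * y) := by
  obtain ⟨L, hL⟩ := hL
  have hdiff := uniform_littleO_sum_ET_sub hprob hinf hL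
  constructor <;> refine uniform_littleO_of_sub fun δ hδ => ?_ <;>
    obtain ⟨Y, hY, h⟩ := hdiff δ hδ <;> refine ⟨Y, hY, fun n y hy => ?_⟩
  · rw [add_sub_add_left_eq_sub, ← Finset.sum_sub_distrib]
    exact h n y hy
  · rw [add_sub_add_left_eq_sub, norm_sub_rev, ← Finset.sum_sub_distrib]
    exact h n y hy

end
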